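/- Let r be a power of p and m = (m_j)_{j≥0} an integer sequence with m_0 = 1 and m_j ≥ 2 for all j ≥ 1, and suppose m_j ≥ 3 for all sufficiently large j. Then for all sufficiently large j, w_{r_j}*(ξ(r,m)) ≤ r_j r_{j+1}³ / (r_{j+1} − r_j²) − 1. -/

import Mathlib

open Polynomial Filter Set
open scoped Classical

noncomputable section

namespace OotoT

variable (Fq : Type) [Field Fq]

/-- We model the field `F_q((T⁻¹))` of Laurent series in `T⁻¹` as `LaurentSeries Fq`,
whose canonical variable `u` plays the role of `T⁻¹`.  Thus `T` itself is `u⁻¹`. -/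
def Tel : LaurentSeries Fq := (HahnSeries.single (1 : ℤ) (1 : Fq))⁻¹

/-- The canonical ring embedding `F_q[T] → F_q((T⁻¹))`, sending `T ↦ u⁻¹`. -/
def ringHomT : Polynomial Fq →+* LaurentSeries Fq :=
  Polynomial.eval₂RingHom (HahnSeries.C : Fq →+* LaurentSeries Fq) (Tel Fq)

/-- The absolute value on `F_q((T⁻¹))`: `|0| = 0` and `|ξ| = q^{-N}` where
`ξ = Σ_{n ≥ N} a_n T^{-n}` with `a_N ≠ 0`; in our model `N` is the order of `ξ`
as a Hahn series in `u = T⁻¹`. -/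
def absL (q : ℕ) (ξ : LaurentSeries Fq) : ℝ :=
  if ξ = 0 then 0 else (q : ℝ) ^ (-ξ.order)

/-- Evaluation of a polynomial `P(X) ∈ (F_q[T])[X]` at `ξ ∈ F_q((T⁻¹))`. -/
def evalP (ξ : LaurentSeries Fq) (P : Polynomial (Polynomial Fq)) : LaurentSeries Fq :=
  Polynomial.eval₂ (ringHomT Fq) ξ P

/-- The height of `P(X) ∈ (F_q[T])[X]`: the maximum of the absolute values of its
coefficients.  A nonzero `c ∈ F_q[T]` has `|c| = q^{deg c}`, so for `P ≠ 0` the height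
is `q` raised to the maximal degree of a (nonzero) coefficient of `P`. -/
def heightP (q : ℕ) (P : Polynomial (Polynomial Fq)) : ℝ :=
  if P = 0 then 0 else (q : ℝ) ^ (P.support.sup fun i => (P.coeff i).natDegree)

/-- `w_n(ξ)`: the supremum (in the extended reals) of the real numbers `w` such that
`0 < |P(ξ)| ≤ H(P)^{-w}` for infinitely many `P(X) ∈ (F_q[T])[X]` of degree at most `n`. -/
def wn (q : ℕ) (n : ℕ) (ξ : LaurentSeries Fq) : EReal :=
  sSup ((fun w : ℝ => (w : EReal)) ''
    {w : ℝ | {P : Polynomial (Polynomial Fq) | P.natDegree ≤ n ∧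
      0 < absL Fq q (evalP Fq ξ P) ∧
      absL Fq q (evalP Fq ξ P) ≤ heightP Fq q P ^ (-w)}.Infinite})

/-- `w(ξ) = limsup_{n→∞} w_n(ξ)/n`. -/
def wB (q : ℕ) (ξ : LaurentSeries Fq) : EReal :=
  Filter.limsup (fun n : ℕ => wn Fq q n ξ / (n : EReal)) Filter.atTop

/-- `ξ` is an `A`-number if `w(ξ) = 0`. -/
def IsANumber (q : ℕ) (ξ : LaurentSeries Fq) : Prop := wB Fq q ξ = 0

/-- `ξ` is an `S`-number if `0 < w(ξ) < +∞`. -/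
def IsSNumber (q : ℕ) (ξ : LaurentSeries Fq) : Prop := 0 < wB Fq q ξ ∧ wB Fq q ξ < ⊤

/-- `ξ` is a `T`-number if `w(ξ) = +∞` and `w_n(ξ) < +∞` for all `n ≥ 1`. -/
def IsTNumber (q : ℕ) (ξ : LaurentSeries Fq) : Prop :=
  wB Fq q ξ = ⊤ ∧ ∀ n : ℕ, 1 ≤ n → wn Fq q n ξ < ⊤

/-- `ξ` is a `U`-number if `w(ξ) = +∞` and `w_n(ξ) = +∞` for some `n ≥ 1`. -/
def IsUNumber (q : ℕ) (ξ : LaurentSeries Fq) : Prop :=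
  wB Fq q ξ = ⊤ ∧ ∃ n : ℕ, 1 ≤ n ∧ wn Fq q n ξ = ⊤

/-- The type `t(ξ) = limsup_{n→∞} (log w_n(ξ))/(log n)` of a `T`-number (as an
extended real; for a `T`-number each `w_n(ξ)` is a finite real, recovered by `toReal`). -/
def typeT (q : ℕ) (ξ : LaurentSeries Fq) : EReal :=
  Filter.limsup
    (fun n : ℕ => ((Real.log (wn Fq q n ξ).toReal / Real.log n : ℝ) : EReal)) Filter.atTop

/-! ### The algebraic closure side -/

/-- The algebraic closure of `F_q((T⁻¹))`. -/
abbrev AC := AlgebraicClosure (LaurentSeries Fq)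

/-- The canonical embedding of `F_q((T⁻¹))` into its algebraic closure. -/
def iota : LaurentSeries Fq →+* AC Fq := algebraMap _ _

/-- The embedding `F_q[T] → AC`. -/
def ringHomTC : Polynomial Fq →+* AC Fq := (iota Fq).comp (ringHomT Fq)

/-- Evaluation of `P(X) ∈ (F_q[T])[X]` at an element of the algebraic closure. -/
def evalPC (α : AC Fq) (P : Polynomial (Polynomial Fq)) : AC Fq :=
  Polynomial.eval₂ (ringHomTC Fq) α P

/-- `P ∈ (F_q[T])[X]` is *the* minimal polynomial of `α`: it is non-constant, irreducible,
primitive, its leading coefficient is monic (in `T`), and `P(α) = 0`.  For `α` algebraic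
over `F_q(T)` such a polynomial exists and is unique. -/
def IsMinPolyOf (α : AC Fq) (P : Polynomial (Polynomial Fq)) : Prop :=
  0 < P.natDegree ∧ Irreducible P ∧ P.IsPrimitive ∧ P.leadingCoeff.Monic ∧ evalPC Fq α P = 0

/-- `α` is algebraic over `F_q(T)`. -/
def IsAlgT (α : AC Fq) : Prop := ∃ P, IsMinPolyOf Fq α P

/-- The degree of an algebraic `α`: the degree of its minimal polynomial. -/
def degT (α : AC Fq) : ℕ := if h : IsAlgT Fq α then h.choose.natDegree else 0

/-- The height of an algebraic `α`: the height of its minimal polynomial. -/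
def heightT (q : ℕ) (α : AC Fq) : ℝ := if h : IsAlgT Fq α then heightP Fq q h.choose else 0

/-- The unique extension of the absolute value to the algebraic closure of `F_q((T⁻¹))`,
given by the standard formula `|x| = |N_{K(x)/K}(x)|^{1/[K(x):K]}`, i.e.
`|x| = |c₀|^{1/d}` where `c₀` is the constant coefficient and `d` the degree of the
minimal polynomial of `x` over `K = F_q((T⁻¹))`. -/
def absC (q : ℕ) (x : AC Fq) : ℝ :=
  absL Fq q ((minpoly (LaurentSeries Fq) x).coeff 0) ^
    (((minpoly (LaurentSeries Fq) x).natDegree : ℝ)⁻¹)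

/-- `w_n^*(ξ)`: the supremum (in the extended reals) of the real numbers `w` such that
`0 < |ξ - α| ≤ H(α)^{-w-1}` for infinitely many `α` algebraic over `F_q(T)` of degree
at most `n`. -/
def wnStar (q : ℕ) (n : ℕ) (ξ : LaurentSeries Fq) : EReal :=
  sSup ((fun w : ℝ => (w : EReal)) ''
    {w : ℝ | {α : AC Fq | IsAlgT Fq α ∧ degT Fq α ≤ n ∧
      0 < absC Fq q (iota Fq ξ - α) ∧
      absC Fq q (iota Fq ξ - α) ≤ heightT Fq q α ^ (-w - 1)}.Infinite})

/-- `w^*(ξ) = limsup_{n→∞} w_n^*(ξ)/n`. -/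
def wBStar (q : ℕ) (ξ : LaurentSeries Fq) : EReal :=
  Filter.limsup (fun n : ℕ => wnStar Fq q n ξ / (n : EReal)) Filter.atTop

/-- `ξ` is an `A*`-number if `w^*(ξ) = 0`. -/
def IsAStarNumber (q : ℕ) (ξ : LaurentSeries Fq) : Prop := wBStar Fq q ξ = 0

/-- `ξ` is a `T*`-number if `w^*(ξ) = +∞` and `w_n^*(ξ) < +∞` for all `n ≥ 1`. -/
def IsTStarNumber (q : ℕ) (ξ : LaurentSeries Fq) : Prop :=
  wBStar Fq q ξ = ⊤ ∧ ∀ n : ℕ, 1 ≤ n → wnStar Fq q n ξ < ⊤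

/-- The `*`-type `t^*(ξ) = limsup_{n→∞} (log w_n^*(ξ))/(log n)` of a `T*`-number. -/
def typeTStar (q : ℕ) (ξ : LaurentSeries Fq) : EReal :=
  Filter.limsup
    (fun n : ℕ => ((Real.log (wnStar Fq q n ξ).toReal / Real.log n : ℝ) : EReal)) Filter.atTop

/-! ### The Laurent series `ξ(r, m)` -/

/-- `r_j = r^{m_0 m_1 ⋯ m_j}`. -/
def rr (r : ℕ) (m : ℕ → ℕ) (j : ℕ) : ℕ := r ^ (∏ i ∈ Finset.range (j + 1), m i)

/-- `α_j(r, m) = Σ_{n=1}^∞ T^{-r_j^n}`, i.e. the power series in `u = T⁻¹` whose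
`k`-th coefficient is `1` exactly when `k = r_j^n` for some `n ≥ 1`. -/
def alphaJ (r : ℕ) (m : ℕ → ℕ) (j : ℕ) : LaurentSeries Fq :=
  HahnSeries.ofPowerSeries ℤ Fq (PowerSeries.mk fun k =>
    if ∃ n : ℕ, 1 ≤ n ∧ k = rr r m j ^ n then 1 else 0)

/-- `ξ_a(r, m) = Σ_{j=0}^∞ a_j α_j(r, m)`, described coefficientwise: the coefficient of
`T^{-k}` is the (finite) sum over `j` of `a_j` times the coefficient of `T^{-k}` in
`α_j(r, m)`. -/
def xiA (r : ℕ) (m : ℕ → ℕ) (a : ℕ → ℕ) : LaurentSeries Fq :=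
  HahnSeries.ofPowerSeries ℤ Fq (PowerSeries.mk fun k =>
    ∑ᶠ j : ℕ, (a j : Fq) * (if ∃ n : ℕ, 1 ≤ n ∧ k = rr r m j ^ n then 1 else 0))

/-- `ξ(r, m) = Σ_{j=0}^∞ α_j(r, m)`. -/
def xi (r : ℕ) (m : ℕ → ℕ) : LaurentSeries Fq := xiA Fq r m fun _ => 1

/-! ### Algebraicity and algebraic dependence over `F_q(T)` for Laurent series -/

/-- `ξ ∈ F_q((T⁻¹))` is algebraic over `F_q(T)`. -/
def IsAlgLS (ξ : LaurentSeries Fq) : Prop :=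
  ∃ P : Polynomial (Polynomial Fq), P ≠ 0 ∧ evalP Fq ξ P = 0

/-- Evaluation of a two-variable polynomial `F(X, Y) ∈ (F_q[T])[X, Y]` (coded as an
iterated polynomial ring, `T` innermost, then `X`, then `Y`) at `(ξ, η)`. -/
def evalXY (ξ η : LaurentSeries Fq) (F : Polynomial (Polynomial (Polynomial Fq))) :
    LaurentSeries Fq :=
  Polynomial.eval₂ (Polynomial.eval₂RingHom (ringHomT Fq) ξ) η F

/-- `ξ` and `η` are algebraically dependent over `F_q(T)`. -/
def AlgDep (ξ η : LaurentSeries Fq) : Prop :=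
  ∃ F : Polynomial (Polynomial (Polynomial Fq)), F ≠ 0 ∧ evalXY Fq ξ η F = 0

/-- `deg_X` of `F(X, Y) ∈ (F_q[T])[X, Y]` in our encoding. -/
def degX (F : Polynomial (Polynomial (Polynomial Fq))) : ℕ :=
  F.support.sup fun i => (F.coeff i).natDegree

/-- `F(X, Y) ∈ (F_q[T])[X, Y]` is primitive (in `X` and `Y`): no non-unit of `F_q[T]`
divides all of its coefficients. -/
def IsPrimitiveXY (F : Polynomial (Polynomial (Polynomial Fq))) : Prop :=
  ∀ c : Polynomial Fq, (∀ i j : ℕ, c ∣ ((F.coeff i).coeff j)) → IsUnit c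

end OotoT

namespace OotoT

/-! ### Nonarchimedean estimates for determinants, resultants and factors -/

section Nonarchimedean

variable {K : Type*} [Field K] {v : AbsoluteValue K ℝ}

/-- A finite sum is bounded by any common bound of its terms. -/
lemma abv_sum_le (hv : IsNonarchimedean v) {ι : Type*} (s : Finset ι) (f : ι → K) {B : ℝ}
    (hB : 0 ≤ B) (hf : ∀ i ∈ s, v (f i) ≤ B) : v (∑ i ∈ s, f i) ≤ B := by
  induction s using Finset.induction_on with
  | empty => simpa using hB
  | insert a s ha ih =>
    rw [Finset.sum_insert ha]
    refine (hv _ _).trans (max_le (hf a (by simp)) (ih fun i hi => hf i (by simp [hi])))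

lemma abv_eval_le (hv : IsNonarchimedean v) (f : K[X]) {x : K} (hx : v x ≤ 1) {B : ℝ}
    (hf : ∀ i, v (f.coeff i) ≤ B) : v (f.eval x) ≤ B := by
  have hB : 0 ≤ B := (v.nonneg _).trans (hf 0)
  rw [eval_eq_sum_range]
  refine abv_sum_le hv _ _ hB fun i _ => ?_
  rw [map_mul, map_pow]
  calc v (f.coeff i) * v x ^ i ≤ B * 1 :=
        mul_le_mul (hf i) (pow_le_one₀ (v.nonneg _) hx) (pow_nonneg (v.nonneg _) _) hB
    _ = B := mul_one B

/-- Leibniz expansion bound for a determinant whose entries are bounded by a product of a row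
weight and a column weight. -/
lemma abv_det_le (hv : IsNonarchimedean v) {n : Type*} [Fintype n] [DecidableEq n]
    (A : Matrix n n K) (e c : n → ℝ) (he : ∀ i, 0 ≤ e i) (hc : ∀ i, 0 ≤ c i)
    (hA : ∀ i j, v (A i j) ≤ e i * c j) : v A.det ≤ (∏ i, e i) * ∏ j, c j := by
  rw [Matrix.det_apply]
  refine abv_sum_le hv _ _
    (mul_nonneg (Finset.prod_nonneg fun i _ => he i) (Finset.prod_nonneg fun i _ => hc i))
    fun σ _ => ?_
  have hsign : v (Equiv.Perm.sign σ • ∏ i, A (σ i) i) = v (∏ i, A (σ i) i) := by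
    rcases Int.units_eq_one_or (Equiv.Perm.sign σ) with h | h <;> simp [h]
  rw [hsign, map_prod, ← Equiv.prod_comp σ e, ← Finset.prod_mul_distrib]
  exact Finset.prod_le_prod (fun i _ => v.nonneg _) fun i _ => hA _ _

/-- Row `v ᵥ* M` of the Sylvester matrix `M` for the vector `v` of powers of `x`. -/
lemma vecMul_sylvester (f g : K[X]) (m n : ℕ) (hf : f.natDegree ≤ m) (hg : g.natDegree ≤ n)
    (x : K) :
    Matrix.vecMul (fun i : Fin (m + n) => x ^ (i : ℕ)) (sylvester f g m n) =
      fun j => j.addCases (fun j₁ => x ^ (j₁ : ℕ) * g.eval x) (fun j₁ => x ^ (j₁ : ℕ) * f.eval x) := by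
  have key : ∀ (N a k : ℕ) (h : K[X]), h.natDegree ≤ k → a + k < N →
      ∑ i : Fin N, x ^ (i : ℕ) * (if (i : ℕ) ∈ Set.Icc a (a + k) then h.coeff (i - a) else 0) =
        x ^ a * h.eval x := by
    intro N a k h hk hN
    rw [Fin.sum_univ_eq_sum_range
      (fun i => x ^ i * (if i ∈ Set.Icc a (a + k) then h.coeff (i - a) else 0)) N,
      eval_eq_sum_range' (Nat.lt_succ_of_le hk), Finset.mul_sum]
    have hsub : Finset.Ico a (a + (k + 1)) ⊆ Finset.range N := by
      intro i hi
      simp only [Finset.mem_Ico, Finset.mem_range] at hi ⊢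
      omega
    rw [← Finset.sum_subset hsub]
    · rw [Finset.sum_Ico_eq_sum_range]
      simp only [Nat.add_sub_cancel_left]
      refine Finset.sum_congr rfl fun i hi => ?_
      rw [if_pos, pow_add]
      · ring
      · simp only [Finset.mem_range] at hi
        simp only [Set.mem_Icc]
        omega
    · intro i _ hi
      rw [if_neg, mul_zero]
      simp only [Finset.mem_Ico, Set.mem_Icc] at hi ⊢
      omega
  funext j
  induction j using Fin.addCases with
  | left j =>
    simpa [Matrix.vecMul, dotProduct, sylvester] using key (m + n) j n g hg (by omega)
  | right j =>
    simpa [Matrix.vecMul, dotProduct, sylvester] using key (m + n) j m f hf (by omega)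

/-- Two polynomials that are both small at a common point have a small resultant. -/
lemma abv_resultant_le (hv : IsNonarchimedean v) (f g : K[X]) (m n : ℕ) (hf : f.natDegree ≤ m)
    (hg : g.natDegree ≤ n) (hm : 0 < m) {x : K} (hx : v x ≤ 1) {F G ε : ℝ} (hF : 0 ≤ F)
    (hG : 0 ≤ G) (hfF : ∀ i, v (f.coeff i) ≤ F) (hgG : ∀ i, v (g.coeff i) ≤ G) (hε : 0 ≤ ε)
    (hfx : v (f.eval x) ≤ ε * F) (hgx : v (g.eval x) ≤ ε * G) :
    v (resultant f g m n) ≤ ε * (G ^ m * F ^ n) := by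
  set A := sylvester f g m n with hA
  set i₀ : Fin (m + n) := ⟨0, by omega⟩ with hi₀
  set w : Fin (m + n) → K := Matrix.vecMul (fun i : Fin (m + n) => x ^ (i : ℕ)) A with hw
  have hdet : resultant f g m n = (A.updateRow i₀ w).det := by
    rw [← Matrix.cramer_transpose_apply, Matrix.cramer_eq_adjugate_mulVec, hw,
      ← Matrix.mulVec_transpose, Matrix.mulVec_mulVec, Matrix.adjugate_mul]
    simp [Matrix.smul_mulVec, hi₀, resultant, hA]
  set c : Fin (m + n) → ℝ := fun j => j.addCases (fun _ => G) (fun _ => F) with hc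
  have hpow : ∀ k : ℕ, v x ^ k ≤ 1 := fun k => pow_le_one₀ (v.nonneg _) hx
  have hbound := abv_det_le hv (A.updateRow i₀ w) (fun i => if i = i₀ then ε else 1) c
    (fun i => by split_ifs <;> positivity)
    (fun j => by
      induction j using Fin.addCases with
      | left j => simpa [hc] using hG
      | right j => simpa [hc] using hF)
    (fun i j => by
      by_cases hi : i = i₀
      · subst hi
        rw [Matrix.updateRow_self, hw, vecMul_sylvester f g m n hf hg]
        induction j using Fin.addCases with
        | left j =>
          simp only [hc, Fin.addCases_left, map_mul, map_pow, if_true]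
          calc v x ^ (j : ℕ) * v (g.eval x) ≤ 1 * v (g.eval x) :=
                mul_le_mul_of_nonneg_right (hpow _) (v.nonneg _)
            _ ≤ ε * G := by simpa using hgx
        | right j =>
          simp only [hc, Fin.addCases_right, map_mul, map_pow, if_true]
          calc v x ^ (j : ℕ) * v (f.eval x) ≤ 1 * v (f.eval x) :=
                mul_le_mul_of_nonneg_right (hpow _) (v.nonneg _)
            _ ≤ ε * F := by simpa using hfx
      · rw [Matrix.updateRow_ne hi, if_neg hi, one_mul, hA]
        induction j using Fin.addCases with
        | left j =>
          simp only [sylvester, Matrix.of_apply, hc, Fin.addCases_left]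
          split_ifs
          · exact hgG _
          · simpa using hG
        | right j =>
          simp only [sylvester, Matrix.of_apply, hc, Fin.addCases_right]
          split_ifs
          · exact hfF _
          · simpa using hF)
  rw [hdet]
  refine hbound.trans_eq ?_
  rw [Finset.prod_ite_eq' Finset.univ i₀ fun _ => ε, Fin.prod_univ_add]
  simp [hc]

/-- A monic factor of a polynomial cannot be much smaller than the polynomial at an integral
point. -/
lemma abv_eval_le_mul_of_dvd (hv : IsNonarchimedean v) {f M : K[X]} (hM : M.Monic) (hdvd : M ∣ f)
    {x : K} (hx : v x ≤ 1) {B : ℝ} (hf : ∀ i, v (f.coeff i) ≤ B) :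
    v (f.eval x) ≤ B * v (M.eval x) := by
  obtain ⟨S, rfl⟩ := hdvd
  have hB : 0 ≤ B := (v.nonneg _).trans (hf 0)
  have hM1 : 1 ≤ M.gaussNorm v 1 := by
    simpa [hM.leadingCoeff] using M.le_gaussNorm v zero_le_one M.natDegree
  have hMS : (M * S).gaussNorm v 1 ≤ B := by
    obtain ⟨i, hi⟩ := (M * S).exists_eq_gaussNorm v 1
    rw [hi]
    simpa using hf i
  have hS : v (S.eval x) ≤ B := by
    refine (abv_eval_le hv S hx fun i => ?_).trans hMS
    rw [gaussNorm_mul hv one_pos]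
    have h1 : v (S.coeff i) ≤ S.gaussNorm v 1 := by simpa using S.le_gaussNorm v zero_le_one i
    exact h1.trans (le_mul_of_one_le_left (S.gaussNorm_nonneg v zero_le_one) hM1)
  rw [eval_mul, map_mul, mul_comm]
  exact mul_le_mul_of_nonneg_right hS (v.nonneg _)

end Nonarchimedean

end OotoT
namespace OotoT

/-! ### The absolute value on Laurent series -/

section Laurent

variable {Fq : Type} [Field Fq] {q : ℕ}

lemma absL_le_of_coeff (hq : 1 < q) {x : LaurentSeries Fq} {N : ℤ}
    (h : ∀ k < N, x.coeff k = 0) : absL Fq q x ≤ (q : ℝ) ^ (-N) := by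
  unfold absL
  split_ifs with hx
  · positivity
  · refine zpow_le_zpow_right₀ (by exact_mod_cast hq.le) (neg_le_neg ?_)
    by_contra! hlt
    exact hx (HahnSeries.coeff_order_eq_zero.1 (h _ hlt))

lemma le_absL_of_coeff_ne_zero (hq : 1 < q) {x : LaurentSeries Fq} {N : ℤ}
    (h : x.coeff N ≠ 0) : (q : ℝ) ^ (-N) ≤ absL Fq q x := by
  have hx : x ≠ 0 := fun hx => h (by simp [hx])
  rw [absL, if_neg hx]
  exact zpow_le_zpow_right₀ (by exact_mod_cast hq.le)
    (neg_le_neg (HahnSeries.order_le_of_coeff_ne_zero h))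

variable (Fq) in
lemma absL_add_le (hq : 1 < q) (x y : LaurentSeries Fq) :
    absL Fq q (x + y) ≤ max (absL Fq q x) (absL Fq q y) := by
  by_cases hx : x = 0
  · simp [hx]
  by_cases hy : y = 0
  · simp [hy]
  have h : absL Fq q (x + y) ≤ (q : ℝ) ^ (-min x.order y.order) :=
    absL_le_of_coeff hq fun k hk => by
      rw [HahnSeries.coeff_add,
        HahnSeries.coeff_eq_zero_of_lt_order (hk.trans_le (min_le_left _ _)),
        HahnSeries.coeff_eq_zero_of_lt_order (hk.trans_le (min_le_right _ _)), add_zero]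
  refine h.trans ?_
  rcases min_choice x.order y.order with h | h <;> rw [h] <;> simp [absL, hx, hy]

variable (Fq) in
/-- `absL` as a bundled absolute value. -/
def absV (hq : 1 < q) : AbsoluteValue (LaurentSeries Fq) ℝ where
  toFun := absL Fq q
  map_mul' x y := by
    by_cases hx : x = 0
    · simp [absL, hx]
    by_cases hy : y = 0
    · simp [absL, hy]
    have hq0 : (q : ℝ) ≠ 0 := by positivity
    simp only [absL, hx, hy, mul_eq_zero, or_self, if_false]
    rw [HahnSeries.order_mul hx hy, neg_add, zpow_add₀ hq0]
  nonneg' x := by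
    unfold absL
    split_ifs <;> positivity
  eq_zero' x := by
    have hq0 : (q : ℝ) ≠ 0 := by positivity
    simp only [absL]
    split_ifs with h
    · simp [h]
    · simp [h, zpow_ne_zero, hq0]
  add_le' x y := by
    have h0 : ∀ z, 0 ≤ absL Fq q z := fun z => by unfold absL; split_ifs <;> positivity
    exact (absL_add_le Fq hq x y).trans (max_le_add_of_nonneg (h0 x) (h0 y))

lemma absV_apply (hq : 1 < q) (x : LaurentSeries Fq) : absV Fq hq x = absL Fq q x := rfl

lemma isNonarchimedean_absV (hq : 1 < q) : IsNonarchimedean (absV Fq hq) :=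
  fun x y => absL_add_le Fq hq x y

lemma Tel_pow (n : ℕ) : Tel Fq ^ n = HahnSeries.single (-(n : ℤ)) (1 : Fq) := by
  rw [Tel, HahnSeries.inv_single, HahnSeries.single_pow]
  simp

lemma coeff_ringHomT (c : Polynomial Fq) (k : ℤ) :
    (ringHomT Fq c).coeff k = if k ≤ 0 then c.coeff (-k).toNat else 0 := by
  induction c using Polynomial.induction_on' with
  | add a b ha hb =>
    rw [map_add, HahnSeries.coeff_add, ha, hb]
    split_ifs <;> simp
  | monomial n a =>
    rw [ringHomT, coe_eval₂RingHom, eval₂_monomial, Tel_pow, HahnSeries.C_apply,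
      HahnSeries.single_mul_single, HahnSeries.coeff_single, Polynomial.coeff_monomial]
    simp only [zero_add, mul_one]
    split_ifs with h1 h2 h3 h3 <;> first | rfl | omega

lemma absL_ringHomT_le (hq : 1 < q) {c : Polynomial Fq} {h : ℕ} (hc : c.natDegree ≤ h) :
    absL Fq q (ringHomT Fq c) ≤ (q : ℝ) ^ h := by
  have := absL_le_of_coeff (Fq := Fq) hq (x := ringHomT Fq c) (N := -(h : ℤ)) fun k hk => by
    rw [coeff_ringHomT, if_pos (by omega), coeff_eq_zero_of_natDegree_lt (by omega)]
  simpa using this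

lemma one_le_absL_ringHomT (hq : 1 < q) {c : Polynomial Fq} (hc : c ≠ 0) :
    1 ≤ absL Fq q (ringHomT Fq c) := by
  have h := le_absL_of_coeff_ne_zero (Fq := Fq) hq (x := ringHomT Fq c) (N := -(c.natDegree : ℤ))
    (by simpa [coeff_ringHomT] using hc)
  refine le_trans ?_ h
  rw [neg_neg, zpow_natCast]
  exact one_le_pow₀ (by exact_mod_cast hq.le)

lemma ringHomT_injective : Function.Injective (ringHomT Fq) := by
  refine (injective_iff_map_eq_zero _).2 fun c hc => ?_
  by_contra h
  have := one_le_absL_ringHomT (Fq := Fq) one_lt_two h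
  rw [hc] at this
  norm_num [absL] at this

lemma evalP_eq_eval_map (ξ : LaurentSeries Fq) (P : Polynomial (Polynomial Fq)) :
    evalP Fq ξ P = (P.map (ringHomT Fq)).eval ξ := by
  rw [evalP, eval_map]

lemma map_dvd_map_of_map_fraction_dvd {A F L : Type*} [CommRing A] [IsDomain A] [Field F]
    [Algebra A F] [IsFractionRing A F] [Field L] {φ : A →+* L} (hφ : Function.Injective φ)
    {P Q : A[X]} (h : P.map (algebraMap A F) ∣ Q.map (algebraMap A F)) :
    P.map φ ∣ Q.map φ := by
  have hcomp : (IsFractionRing.lift (K := F) hφ).comp (algebraMap A F) = φ :=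
    RingHom.ext fun c => IsFractionRing.lift_algebraMap hφ c
  simpa only [Polynomial.map_map, hcomp] using
    Polynomial.map_dvd (IsFractionRing.lift (K := F) hφ) h

/-- Liouville-type dichotomy: a monic factor `M` over `F_q((T⁻¹))` of an irreducible primitive
polynomial `P` is either a factor of `Q`, or `M` and `Q` cannot both be small at `ξ`. -/
lemma le_or_one_le_of_irreducible (hq : 1 < q) {P Q : Polynomial (Polynomial Fq)}
    (hP : Irreducible P) (hprim : P.IsPrimitive) (hdeg : 0 < P.natDegree) {h h' : ℕ}
    (hPh : ∀ i, (P.coeff i).natDegree ≤ h) (hQh : ∀ i, (Q.coeff i).natDegree ≤ h')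
    {ξ : LaurentSeries Fq} (hξ : absL Fq q ξ ≤ 1) {M : Polynomial (LaurentSeries Fq)}
    (hM : M.Monic) (hdvd : M ∣ P.map (ringHomT Fq)) :
    absL Fq q (evalP Fq ξ Q) ≤ (q : ℝ) ^ h' * absL Fq q (M.eval ξ) ∨
      1 ≤ max (absL Fq q (M.eval ξ)) (absL Fq q (evalP Fq ξ Q) / (q : ℝ) ^ h') *
        (((q : ℝ) ^ h') ^ P.natDegree * ((q : ℝ) ^ h) ^ Q.natDegree) := by
  have hv := isNonarchimedean_absV (Fq := Fq) hq
  have hq0 : (0 : ℝ) < q := by positivity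
  simp only [evalP_eq_eval_map]
  have hPc : ∀ i, absV Fq hq ((P.map (ringHomT Fq)).coeff i) ≤ (q : ℝ) ^ h := fun i => by
    rw [coeff_map]; exact absL_ringHomT_le hq (hPh i)
  have hQc : ∀ i, absV Fq hq ((Q.map (ringHomT Fq)).coeff i) ≤ (q : ℝ) ^ h' := fun i => by
    rw [coeff_map]; exact absL_ringHomT_le hq (hQh i)
  by_cases hPQ : P.map (algebraMap (Polynomial Fq) (RatFunc Fq)) ∣
      Q.map (algebraMap (Polynomial Fq) (RatFunc Fq))
  · left
    have hPQ' := map_dvd_map_of_map_fraction_dvd ringHomT_injective hPQ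
    exact abv_eval_le_mul_of_dvd hv hM (hdvd.trans hPQ') hξ hQc
  · right
    have hinj : Function.Injective (algebraMap (Polynomial Fq) (RatFunc Fq)) :=
      IsFractionRing.injective _ _
    have hirr := (hprim.irreducible_iff_irreducible_map_fraction_map (K := RatFunc Fq)).1 hP
    have hcop := hirr.coprime_iff_not_dvd.2 hPQ
    have hres : resultant P Q P.natDegree Q.natDegree ≠ 0 := by
      intro h0
      refine resultant_ne_zero _ _ hcop ?_
      rw [natDegree_map_eq_of_injective hinj, natDegree_map_eq_of_injective hinj,
        resultant_map_map, h0, map_zero]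
    have h1 := one_le_absL_ringHomT (Fq := Fq) hq hres
    rw [← resultant_map_map] at h1
    refine h1.trans (abv_resultant_le hv _ _ _ _ natDegree_map_le natDegree_map_le hdeg hξ
      (by positivity) (by positivity) hPc hQc (le_max_of_le_left ((absV Fq hq).nonneg _)) ?_ ?_)
    · refine (abv_eval_le_mul_of_dvd hv hM hdvd hξ hPc).trans ?_
      rw [mul_comm]
      exact mul_le_mul_of_nonneg_right (le_max_left _ _) (by positivity)
    · rw [← div_le_iff₀ (by positivity)]
      exact le_max_right _ _

/-- The coefficient polynomial of the truncation `T^h x` to nonnegative powers of `T`. -/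
lemma exists_polynomial_trunc (x : LaurentSeries Fq) (hx : ∀ k < 0, x.coeff k = 0) (h : ℕ) :
    ∃ G : Polynomial Fq, G.natDegree ≤ h ∧
      ∀ k : ℤ, (Tel Fq ^ h * x - ringHomT Fq G).coeff k = if k ≤ 0 then 0 else x.coeff (k + h) := by
  refine ⟨∑ i ∈ Finset.range (h + 1), Polynomial.monomial i (x.coeff ((h : ℤ) - i)),
    natDegree_sum_le_of_forall_le _ _ fun i hi => ?_, fun k => ?_⟩
  · exact (natDegree_monomial_le _).trans (by simpa [Nat.lt_succ_iff] using hi)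
  · have hshift : (Tel Fq ^ h * x).coeff k = x.coeff (k + h) := by
      have := HahnSeries.coeff_single_mul_add (r := (1 : Fq)) (x := x) (a := k + h)
        (b := -(h : ℤ))
      rw [Tel_pow]
      simpa using this
    rw [HahnSeries.coeff_sub, hshift, coeff_ringHomT]
    split_ifs with hk
    · obtain ⟨n, rfl⟩ : ∃ n : ℕ, k = -(n : ℤ) := ⟨(-k).toNat, by omega⟩
      simp only [finsetSum_coeff, Polynomial.coeff_monomial, neg_neg, Int.toNat_natCast,
        Finset.sum_ite_eq', Finset.mem_range]
      split_ifs with hn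
      · rw [sub_eq_zero]; congr 1; ring
      · rw [sub_zero, hx _ (by omega)]
    · rw [sub_zero]

/-- The distance to `ξ` in the algebraic closure through the minimal polynomial over
`F_q((T⁻¹))`. -/
lemma absC_iota_sub (hq : 1 < q) (ξ : LaurentSeries Fq) (α : AC Fq) :
    absC Fq q (iota Fq ξ - α) = absL Fq q ((minpoly (LaurentSeries Fq) α).eval ξ) ^
      (((minpoly (LaurentSeries Fq) α).natDegree : ℝ)⁻¹) := by
  have hmin : minpoly (LaurentSeries Fq) (iota Fq ξ - α) =
      (-1) ^ (minpoly (LaurentSeries Fq) α).natDegree *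
        ((minpoly (LaurentSeries Fq) α).comp (X + C ξ)).comp (-X) := by
    rw [← neg_sub, minpoly.neg, iota, minpoly.sub_algebraMap, natDegree_comp, natDegree_X_add_C,
      mul_one]
  have hdeg : (minpoly (LaurentSeries Fq) (iota Fq ξ - α)).natDegree =
      (minpoly (LaurentSeries Fq) α).natDegree := by
    rw [hmin]
    rcases neg_one_pow_eq_or (LaurentSeries Fq)[X]
      (minpoly (LaurentSeries Fq) α).natDegree with h | h <;> rw [h] <;> simp [natDegree_comp]
  have hcoeff : absL Fq q ((minpoly (LaurentSeries Fq) (iota Fq ξ - α)).coeff 0) =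
      absL Fq q ((minpoly (LaurentSeries Fq) α).eval ξ) := by
    rw [hmin, coeff_zero_eq_eval_zero]
    simp only [eval_mul, eval_pow, eval_neg, eval_one, eval_comp, eval_X, eval_add, eval_C,
      neg_zero, zero_add, ← absV_apply hq, map_mul, map_pow,
      (absV Fq hq).map_neg, (absV Fq hq).map_one, one_pow, one_mul]
  rw [absC, hdeg, hcoeff]

lemma le_absC_of_le_absL (hq : 1 < q) {ξ : LaurentSeries Fq} {α : AC Fq} {t : ℕ}
    (h : ((q : ℝ) ^ t)⁻¹ ≤ absL Fq q ((minpoly (LaurentSeries Fq) α).eval ξ)) :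
    ((q : ℝ) ^ t)⁻¹ ≤ absC Fq q (iota Fq ξ - α) := by
  have hα_int : IsIntegral (LaurentSeries Fq) α := Algebra.IsIntegral.isIntegral α
  have hd : 0 < (minpoly (LaurentSeries Fq) α).natDegree := minpoly.natDegree_pos hα_int
  have h1 : (1 : ℝ) ≤ (q : ℝ) ^ t := one_le_pow₀ (by exact_mod_cast hq.le)
  have h0 : 0 < ((q : ℝ) ^ t)⁻¹ := by positivity
  rw [absC_iota_sub hq]
  calc ((q : ℝ) ^ t)⁻¹ = (((q : ℝ) ^ t)⁻¹) ^ (1 : ℝ) := (Real.rpow_one _).symm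
    _ ≤ (((q : ℝ) ^ t)⁻¹) ^ (((minpoly (LaurentSeries Fq) α).natDegree : ℝ)⁻¹) :=
      Real.rpow_le_rpow_of_exponent_ge h0 (inv_le_one_of_one_le₀ h1)
        (inv_le_one_of_one_le₀ (by exact_mod_cast hd))
    _ ≤ _ := Real.rpow_le_rpow h0.le h (by positivity)

lemma minpoly_dvd_of_isMinPolyOf {α : AC Fq} {P : Polynomial (Polynomial Fq)}
    (h : IsMinPolyOf Fq α P) : minpoly (LaurentSeries Fq) α ∣ P.map (ringHomT Fq) := by
  refine minpoly.dvd _ _ ?_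
  rw [aeval_def, eval₂_map]
  exact h.2.2.2.2

/-- The exponent of `q` in the height of a polynomial. -/
def logHeight (P : Polynomial (Polynomial Fq)) : ℕ :=
  P.support.sup fun i => (P.coeff i).natDegree

lemma natDegree_coeff_le_logHeight (P : Polynomial (Polynomial Fq)) (i : ℕ) :
    (P.coeff i).natDegree ≤ logHeight P := by
  by_cases hi : i ∈ P.support
  · exact Finset.le_sup (f := fun i => (P.coeff i).natDegree) hi
  · simp [notMem_support_iff.1 hi]

/-- Northcott property: there are finitely many algebraic elements of bounded degree and height. -/
lemma finite_setOf_logHeight_le [Finite Fq] (n B : ℕ) :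
    {α : AC Fq | ∃ P, IsMinPolyOf Fq α P ∧ P.natDegree ≤ n ∧ logHeight P ≤ B}.Finite := by
  have hS : {P : Polynomial (Polynomial Fq) | P.natDegree ≤ n ∧ logHeight P ≤ B}.Finite := by
    refine Set.Finite.of_finite_image
      (f := fun P (i : Fin (n + 1)) (j : Fin (B + 1)) => (P.coeff i).coeff j) (Set.toFinite _) ?_
    rintro P ⟨hP, hP'⟩ Q ⟨hQ, hQ'⟩ hPQ
    ext i j
    by_cases hi : i < n + 1
    · by_cases hj : j < B + 1
      · exact congrFun (congrFun hPQ ⟨i, hi⟩) ⟨j, hj⟩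
      · have h1 := natDegree_coeff_le_logHeight P i
        have h2 := natDegree_coeff_le_logHeight Q i
        rw [coeff_eq_zero_of_natDegree_lt (p := P.coeff i) (by omega),
          coeff_eq_zero_of_natDegree_lt (p := Q.coeff i) (by omega)]
    · rw [coeff_eq_zero_of_natDegree_lt (p := P) (by omega),
        coeff_eq_zero_of_natDegree_lt (p := Q) (by omega)]
  refine (hS.biUnion fun P _ => (P.map (ringHomTC Fq)).roots.toFinset.finite_toSet).subset ?_
  rintro α ⟨P, hα, hPn, hPB⟩
  simp only [Set.mem_iUnion]
  refine ⟨P, ⟨hPn, hPB⟩, ?_⟩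
  have hne : P.map (ringHomTC Fq) ≠ 0 := by
    have hinj : Function.Injective (ringHomTC Fq) := by
      simpa [ringHomTC] using (iota Fq).injective.comp (ringHomT_injective (Fq := Fq))
    rw [Polynomial.map_ne_zero_iff hinj]
    exact hα.2.1.ne_zero
  have h0 : eval₂ (ringHomTC Fq) α P = 0 := hα.2.2.2.2
  simpa [hne, IsRoot, eval_map] using h0

end Laurent

end OotoT
namespace OotoT

/-! ### Powers of the `r_j` and the coefficients of `ξ(r, m)` -/

section Coefficients

variable {r : ℕ} {m : ℕ → ℕ}

lemma rr_succ (j : ℕ) : rr r m (j + 1) = rr r m j ^ m (j + 1) := by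
  rw [rr, rr, Finset.prod_range_succ, pow_mul]

lemma two_le_rr (hr : 2 ≤ r) (hm : ∀ j, 1 ≤ m j) (j : ℕ) : 2 ≤ rr r m j := by
  have h : ∏ i ∈ Finset.range (j + 1), m i ≠ 0 :=
    Finset.prod_ne_zero_iff.2 fun i _ => (Nat.one_le_iff_ne_zero.1 (hm i))
  exact hr.trans (Nat.le_self_pow h r)

lemma rr_strictMono (hr : 2 ≤ r) (hm : ∀ j, 1 ≤ m j) (hm' : ∀ j, 1 ≤ j → 2 ≤ m j) :
    StrictMono (rr r m) := by
  refine strictMono_nat_of_lt_succ fun j => ?_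
  have h2 := two_le_rr hr hm j
  rw [rr_succ]
  calc rr r m j = rr r m j ^ 1 := (pow_one _).symm
    _ < rr r m j ^ m (j + 1) :=
      Nat.pow_lt_pow_right (by omega) (by have := hm' (j + 1) (by omega); omega)

lemma exists_rr_eq_pow (hm : ∀ j, 1 ≤ m j) {i j : ℕ} (hij : i ≤ j) :
    ∃ s, 1 ≤ s ∧ rr r m j = rr r m i ^ s := by
  induction j, hij using Nat.le_induction with
  | base => exact ⟨1, le_rfl, (pow_one _).symm⟩
  | succ j _ ih =>
    obtain ⟨s, hs, h⟩ := ih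
    exact ⟨s * m (j + 1), Nat.mul_pos hs (hm _), by rw [rr_succ, h, pow_mul]⟩

variable (r m) in
/-- `k` occurs as an exponent in the series `α_i(r, m)`. -/
def IsExponent (i k : ℕ) : Prop := ∃ n : ℕ, 1 ≤ n ∧ k = rr r m i ^ n

lemma IsExponent.le (hr : 2 ≤ r) (hm : ∀ j, 1 ≤ m j) (hm' : ∀ j, 1 ≤ j → 2 ≤ m j) {i k : ℕ}
    (h : IsExponent r m i k) : i ≤ k := by
  obtain ⟨n, hn, rfl⟩ := h
  exact ((rr_strictMono hr hm hm').id_le i).trans (Nat.le_self_pow (by omega) _)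

lemma IsExponent.dvd (hr : 2 ≤ r) (hm : ∀ j, 1 ≤ m j) {i j k : ℕ} (hij : i ≤ j)
    (hk : rr r m j < k) (h : IsExponent r m i k) : rr r m j ∣ k := by
  obtain ⟨n, hn, rfl⟩ := h
  obtain ⟨s, hs, hsj⟩ := exists_rr_eq_pow (r := r) hm hij
  have h2 := two_le_rr hr hm i
  rw [hsj] at hk ⊢
  exact pow_dvd_pow _ ((Nat.pow_lt_pow_iff_right (by omega)).1 hk).le

lemma isExponent_mul_iff (hr : 2 ≤ r) (hm : ∀ j, 1 ≤ m j) {i j l : ℕ} (hij : i ≤ j)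
    (hl : 1 < l) : IsExponent r m i (rr r m j * l) ↔ IsExponent r m i l := by
  obtain ⟨s, hs, hsj⟩ := exists_rr_eq_pow (r := r) hm hij
  have h2 := two_le_rr hr hm i
  rw [hsj]
  constructor
  · rintro ⟨n, hn, h⟩
    have hpos : 0 < rr r m i ^ s := by positivity
    have hsn : s < n := by
      refine (Nat.pow_lt_pow_iff_right (a := rr r m i) (by omega)).1 ?_
      rw [← h]
      exact lt_mul_of_one_lt_right hpos hl
    refine ⟨n - s, by omega, Nat.eq_of_mul_eq_mul_left hpos ?_⟩
    rw [h, ← pow_add]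
    congr 1
    omega
  · rintro ⟨n, hn, rfl⟩
    exact ⟨s + n, by omega, (pow_add _ _ _).symm⟩

lemma IsExponent.exists_pow (hm : ∀ j, 1 ≤ m j) {i j k : ℕ} (hij : j ≤ i)
    (h : IsExponent r m i k) : ∃ M, 1 ≤ M ∧ k = rr r m j ^ M := by
  obtain ⟨n, hn, rfl⟩ := h
  obtain ⟨s, hs, hsj⟩ := exists_rr_eq_pow (r := r) hm hij
  exact ⟨s * n, Nat.mul_pos hs hn, by rw [hsj, pow_mul]⟩

lemma not_isExponent_of_lt_of_lt (hr : 2 ≤ r) (hm : ∀ j, 1 ≤ m j) {i j k N : ℕ} (hij : j ≤ i)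
    (h1 : rr r m j ^ N < k) (h2 : k < rr r m j ^ (N + 1)) : ¬ IsExponent r m i k := by
  intro h
  obtain ⟨M, -, rfl⟩ := h.exists_pow hm hij
  have h3 := two_le_rr hr hm j
  rw [Nat.pow_lt_pow_iff_right (by omega)] at h1 h2
  omega

variable (Fq : Type) [Field Fq]

variable (r m) in
/-- The coefficient of `T^{-k}` in `ξ(r, m)`. -/
def xiCoeff (k : ℕ) : Fq :=
  ∑ᶠ j : ℕ, ((1 : ℕ) : Fq) * (if ∃ n : ℕ, 1 ≤ n ∧ k = rr r m j ^ n then 1 else 0)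

lemma xiCoeff_eq_card (hr : 2 ≤ r) (hm : ∀ j, 1 ≤ m j) (hm' : ∀ j, 1 ≤ j → 2 ≤ m j) {k B : ℕ}
    (hkB : k ≤ B) :
    xiCoeff r m Fq k = (((Finset.range (B + 1)).filter fun i => IsExponent r m i k).card : Fq) := by
  rw [← Finset.sum_boole, xiCoeff, finsum_eq_sum_of_support_subset (s := Finset.range (B + 1))]
  · exact Finset.sum_congr rfl fun i _ => by rw [Nat.cast_one, one_mul]; rfl
  · intro i hi
    have hi' : IsExponent r m i k := by
      by_contra hcon
      unfold IsExponent at hcon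
      exact hi (by simp only [if_neg hcon, mul_zero])
    have := hi'.le hr hm hm'
    simp only [Finset.coe_range, Set.mem_Iio]
    omega

/-- The Artin–Schreier type expression `ξ^{r_j} - ξ`. -/
lemma coeff_xi_pow_sub (p : ℕ) [Fact p.Prime] [CharP Fq p] (hr : ∃ e : ℕ, 0 < e ∧ r = p ^ e)
    (hm : ∀ j, 1 ≤ m j) (hm' : ∀ j, 1 ≤ j → 2 ≤ m j) (j k : ℕ) :
    (xi Fq r m ^ rr r m j - xi Fq r m).coeff (k : ℤ) =
      (if rr r m j ∣ k then xiCoeff r m Fq (k / rr r m j) else 0) - xiCoeff r m Fq k := by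
  obtain ⟨e, he, hre⟩ := hr
  have hp : p.Prime := Fact.out
  have hr2 : 2 ≤ r := hre ▸ hp.two_le.trans (Nat.le_self_pow he.ne' p)
  set s := e * ∏ i ∈ Finset.range (j + 1), m i with hs
  have hrs : rr r m j = p ^ s := by rw [rr, hre, ← pow_mul]
  have hxi : xi Fq r m = HahnSeries.ofPowerSeries ℤ Fq (PowerSeries.mk (xiCoeff r m Fq)) := rfl
  have hpow : (PowerSeries.mk (xiCoeff r m Fq)) ^ p ^ s =
      PowerSeries.map (iterateFrobenius Fq p s)
        (PowerSeries.expand (p ^ s) (pow_ne_zero s hp.ne_zero) (PowerSeries.mk (xiCoeff r m Fq))) :=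
    (MvPowerSeries.map_iterateFrobenius_expand p hp.ne_zero _ s).symm
  have hfrob : ∀ l, iterateFrobenius Fq p s (xiCoeff r m Fq l) = xiCoeff r m Fq l := fun l => by
    rw [xiCoeff_eq_card Fq hr2 hm hm' le_rfl, map_natCast]
  rw [hxi, HahnSeries.coeff_sub, ← map_pow, HahnSeries.ofPowerSeries_apply_coeff,
    HahnSeries.ofPowerSeries_apply_coeff, hrs, hpow, PowerSeries.coeff_map,
    PowerSeries.coeff_expand, PowerSeries.coeff_mk]
  split_ifs
  · rw [PowerSeries.coeff_mk, hfrob]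
  · rw [map_zero, PowerSeries.coeff_mk]

lemma coeff_ofPowerSeries_of_neg (f : PowerSeries Fq) {k : ℤ} (hk : k < 0) :
    (HahnSeries.ofPowerSeries ℤ Fq f).coeff k = 0 := by
  rw [PowerSeries.coeff_coe, if_pos hk]

lemma coeff_xi_pow_sub_of_neg (n : ℕ) {k : ℤ} (hk : k < 0) :
    (xi Fq r m ^ n - xi Fq r m).coeff k = 0 := by
  rw [xi, xiA, ← map_pow, ← map_sub]
  exact coeff_ofPowerSeries_of_neg Fq _ hk

lemma absL_xi_le_one {q : ℕ} (hq : 1 < q) : absL Fq q (xi Fq r m) ≤ 1 := by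
  have := absL_le_of_coeff (Fq := Fq) hq (x := xi Fq r m) (N := 0)
    fun k hk => coeff_ofPowerSeries_of_neg Fq _ hk
  simpa using this

lemma coeff_xi_pow_sub_eq_zero (p : ℕ) [Fact p.Prime] [CharP Fq p]
    (hr : ∃ e : ℕ, 0 < e ∧ r = p ^ e) (hm : ∀ j, 1 ≤ m j) (hm' : ∀ j, 1 ≤ j → 2 ≤ m j)
    {j k N : ℕ} (h1 : rr r m j * rr r m (j + 1) ^ N < k) (h2 : k < rr r m (j + 1) ^ (N + 1)) :
    (xi Fq r m ^ rr r m j - xi Fq r m).coeff (k : ℤ) = 0 := by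
  have hr2 : 2 ≤ r := by
    obtain ⟨e, he, rfl⟩ := hr
    exact (Fact.out : p.Prime).two_le.trans (Nat.le_self_pow he.ne' p)
  have hρ := two_le_rr hr2 hm j
  have hR := two_le_rr hr2 hm (j + 1)
  have hRN : 1 ≤ rr r m (j + 1) ^ N := Nat.one_le_pow _ _ (by omega)
  rw [coeff_xi_pow_sub Fq p hr hm hm']
  have hnot : ∀ i, j + 1 ≤ i → ¬ IsExponent r m i k := fun i hi =>
    not_isExponent_of_lt_of_lt hr2 hm hi (N := N) (by nlinarith) h2
  split_ifs with hdvd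
  · obtain ⟨l, rfl⟩ := hdvd
    have hl : rr r m (j + 1) ^ N < l := Nat.lt_of_mul_lt_mul_left h1
    have hlk : l ≤ rr r m j * l := Nat.le_mul_of_pos_left _ (by omega)
    rw [Nat.mul_div_cancel_left _ (by omega), xiCoeff_eq_card Fq hr2 hm hm' hlk,
      xiCoeff_eq_card Fq hr2 hm hm' le_rfl, sub_eq_zero]
    congr 2
    refine Finset.filter_congr fun i _ => ?_
    rcases Nat.lt_or_ge j i with hi | hi
    · exact iff_of_false (not_isExponent_of_lt_of_lt hr2 hm hi hl (hlk.trans_lt h2)) (hnot i hi)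
    · exact (isExponent_mul_iff hr2 hm hi (by omega)).symm
  · rw [zero_sub, neg_eq_zero, xiCoeff_eq_card Fq hr2 hm hm' le_rfl, Finset.filter_false_of_mem,
      Finset.card_empty, Nat.cast_zero]
    intro i _ hi
    rcases Nat.lt_or_ge j i with hij | hij
    · exact hnot i hij hi
    · exact hdvd (hi.dvd hr2 hm hij (by nlinarith))

lemma coeff_xi_pow_sub_ne_zero (p : ℕ) [Fact p.Prime] [CharP Fq p]
    (hr : ∃ e : ℕ, 0 < e ∧ r = p ^ e) (hm : ∀ j, 1 ≤ m j) (hm' : ∀ j, 1 ≤ j → 2 ≤ m j)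
    {j M : ℕ} (hM : ¬ m (j + 2) ∣ M) :
    (xi Fq r m ^ rr r m j - xi Fq r m).coeff ((rr r m (j + 1) ^ M : ℕ) : ℤ) ≠ 0 := by
  have hr2 : 2 ≤ r := by
    obtain ⟨e, he, rfl⟩ := hr
    exact (Fact.out : p.Prime).two_le.trans (Nat.le_self_pow he.ne' p)
  obtain ⟨M, rfl⟩ : ∃ M', M = M' + 1 :=
    Nat.exists_eq_succ_of_ne_zero fun h => hM (h ▸ dvd_zero _)
  have hρ := two_le_rr hr2 hm j
  have hR := two_le_rr hr2 hm (j + 1)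
  have hlt : rr r m j < rr r m (j + 1) := rr_strictMono hr2 hm hm' (Nat.lt_succ_self j)
  obtain ⟨R', hR'⟩ : rr r m j ∣ rr r m (j + 1) := by
    rw [rr_succ]
    exact dvd_pow_self _ (Nat.one_le_iff_ne_zero.1 (hm _))
  have hR'1 : 1 < R' := by
    by_contra! hcon
    have : rr r m j * R' ≤ rr r m j * 1 := Nat.mul_le_mul_left _ hcon
    omega
  have hRM : 1 ≤ rr r m (j + 1) ^ M := Nat.one_le_pow _ _ (by omega)
  set l := R' * rr r m (j + 1) ^ M with hl
  have hk : rr r m (j + 1) ^ (M + 1) = rr r m j * l := by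
    rw [pow_succ', hl, ← mul_assoc, ← hR']
  have hl1 : rr r m (j + 1) ^ M < l := lt_mul_of_one_lt_left (by omega) hR'1
  have hl2 : l < rr r m (j + 1) ^ (M + 1) := by
    rw [hk]
    exact lt_mul_of_one_lt_left (by omega) hρ
  have hnot : ∀ i, j + 1 ≤ i → ¬ IsExponent r m i l := fun i hi =>
    not_isExponent_of_lt_of_lt hr2 hm hi hl1 hl2
  have hself : IsExponent r m (j + 1) (rr r m j * l) := ⟨M + 1, by omega, hk.symm⟩
  have hcard : (Finset.range (rr r m j * l + 1)).filter (fun i => IsExponent r m i (rr r m j * l)) =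
      insert (j + 1)
        ((Finset.range (rr r m j * l + 1)).filter fun i => IsExponent r m i l) := by
    ext i
    simp only [Finset.mem_filter, Finset.mem_insert, Finset.mem_range]
    rcases lt_trichotomy i (j + 1) with hi | hi | hi
    · rw [isExponent_mul_iff hr2 hm (by omega) (by omega)]
      constructor
      · exact Or.inr
      · rintro (h | h)
        · omega
        · exact h
    · subst hi
      have := hself.le hr2 hm hm'
      simp only [hself, true_or, and_true, iff_true]
      omega
    · refine iff_of_false (fun h => hM ?_) ?_
      · obtain ⟨M', -, h'⟩ := h.2.exists_pow hm (j := j + 2) (by omega)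
        rw [← hk, rr_succ (j + 1), ← pow_mul] at h'
        exact ⟨M', Nat.pow_right_injective hR h'⟩
      · rintro (h | h)
        · omega
        · exact hnot i (by omega) h.2
  have hnm : j + 1 ∉ (Finset.range (rr r m j * l + 1)).filter (fun i => IsExponent r m i l) :=
    fun h => hnot (j + 1) le_rfl (Finset.mem_filter.1 h).2
  rw [coeff_xi_pow_sub Fq p hr hm hm', hk, if_pos (dvd_mul_right _ _),
    Nat.mul_div_cancel_left _ (by omega), xiCoeff_eq_card Fq hr2 hm hm' (hk ▸ hl2.le),
    xiCoeff_eq_card Fq hr2 hm hm' le_rfl, hcard,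
    Finset.card_insert_of_notMem hnm]
  simp

end Coefficients

end OotoT
namespace OotoT

section Approximation

variable {Fq : Type} [Field Fq] {q : ℕ} {r : ℕ} {m : ℕ → ℕ}

/-- The approximants of `ξ(r, m)` coming from the Artin–Schreier type expression
`ξ^{r_j} - ξ`. -/
lemma exists_polynomial_approx (hq : 1 < q) (p : ℕ) [Fact p.Prime] [CharP Fq p]
    (hr : ∃ e : ℕ, 0 < e ∧ r = p ^ e) (hm : ∀ j, 1 ≤ m j) (hm' : ∀ j, 1 ≤ j → 2 ≤ m j)
    (j N : ℕ) :
    ∃ Q : Polynomial (Polynomial Fq), Q.natDegree ≤ rr r m j ∧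
      (∀ i, (Q.coeff i).natDegree ≤ rr r m j * rr r m (j + 1) ^ N) ∧
      absL Fq q (evalP Fq (xi Fq r m) Q) / (q : ℝ) ^ (rr r m j * rr r m (j + 1) ^ N) ≤
        ((q : ℝ) ^ rr r m (j + 1) ^ (N + 1))⁻¹ ∧
      ((q : ℝ) ^ rr r m (j + 1) ^ (N + 2))⁻¹ ≤
        absL Fq q (evalP Fq (xi Fq r m) Q) / (q : ℝ) ^ (rr r m j * rr r m (j + 1) ^ N) := by
  have hr2 : 2 ≤ r := by
    obtain ⟨e, he, rfl⟩ := hr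
    exact (Fact.out : p.Prime).two_le.trans (Nat.le_self_pow he.ne' p)
  have hρ := two_le_rr hr2 hm j
  have hR := two_le_rr hr2 hm (j + 1)
  have hlt : rr r m j < rr r m (j + 1) := rr_strictMono hr2 hm hm' (Nat.lt_succ_self j)
  have hq0 : (0 : ℝ) < q := by positivity
  set ρ := rr r m j with hρdef
  set R := rr r m (j + 1) with hRdef
  set ξ := xi Fq r m with hξ
  set h := ρ * R ^ N with hh
  have hRN : 1 ≤ R ^ N := Nat.one_le_pow _ _ (by omega)
  have hhR : h < R ^ (N + 1) := by
    rw [hh, pow_succ']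
    exact Nat.mul_lt_mul_of_pos_right hlt hRN
  obtain ⟨G, hG, hcoeff⟩ := exists_polynomial_trunc (ξ ^ ρ - ξ)
    (fun k hk => coeff_xi_pow_sub_of_neg Fq ρ hk) h
  have heval : evalP Fq ξ (C (X ^ h) * (X ^ ρ - X) - C G) =
      Tel Fq ^ h * (ξ ^ ρ - ξ) - ringHomT Fq G := by
    rw [evalP, eval₂_sub, eval₂_mul, eval₂_C, eval₂_C, map_pow, eval₂_sub, eval₂_X_pow, eval₂_X]
    simp [ringHomT]
  have hscale : ∀ a : ℕ, ((q : ℝ) ^ a)⁻¹ * (q : ℝ) ^ h = (q : ℝ) ^ (-((a : ℤ) - h)) := fun a => by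
    rw [neg_sub, zpow_sub₀ hq0.ne', zpow_natCast, zpow_natCast, div_eq_mul_inv, mul_comm]
  refine ⟨C (X ^ h) * (X ^ ρ - X) - C G, ?_, fun i => ?_, ?_, ?_⟩
  · compute_degree
    omega
  · rw [coeff_sub, coeff_C_mul, coeff_C]
    refine (natDegree_sub_le _ _).trans (max_le ?_ ?_)
    · refine natDegree_mul_le.trans ?_
      have : ((X ^ ρ - X : Polynomial (Polynomial Fq)).coeff i).natDegree ≤ 0 := by
        rw [coeff_sub, coeff_X_pow, coeff_X]
        split_ifs <;> simp
      rw [natDegree_X_pow]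
      omega
    · split_ifs
      · exact hG
      · simp
  · rw [div_le_iff₀ (by positivity), hscale, heval]
    refine absL_le_of_coeff hq fun k hk => ?_
    rw [hcoeff]
    split_ifs with hk0
    · rfl
    · obtain ⟨n, rfl⟩ : ∃ n : ℕ, k = (n : ℤ) := ⟨k.toNat, by omega⟩
      have := coeff_xi_pow_sub_eq_zero Fq p hr hm hm' (j := j) (k := n + h) (N := N)
        (by rw [← hρdef, ← hRdef, ← hh]; omega) (by rw [← hRdef]; omega)
      exact_mod_cast this
  · rw [le_div_iff₀ (by positivity), heval]
    obtain ⟨M, hM1, hM2, hM⟩ : ∃ M, N + 1 ≤ M ∧ M ≤ N + 2 ∧ ¬ m (j + 2) ∣ M := by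
      by_cases hd : m (j + 2) ∣ N + 1
      · refine ⟨N + 2, by omega, le_rfl, fun hd' => ?_⟩
        have h1 := Nat.le_of_dvd one_pos ((Nat.dvd_add_right hd).1 hd')
        have h2 := hm' (j + 2) (by omega)
        omega
      · exact ⟨N + 1, le_rfl, by omega, hd⟩
    have hRM : R ^ (N + 1) ≤ R ^ M := Nat.pow_le_pow_right (by omega) hM1
    have hRM' : R ^ M ≤ R ^ (N + 2) := Nat.pow_le_pow_right (by omega) hM2
    refine le_trans ?_ (le_absL_of_coeff_ne_zero hq (N := ((R ^ M : ℕ) : ℤ) - h) ?_)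
    · rw [← hscale]
      gcongr
      exact_mod_cast hq.le
    · rw [hcoeff, if_neg (by omega), sub_add_cancel]
      exact coeff_xi_pow_sub_ne_zero Fq p hr hm hm' hM

/-- Lower bound for the minimal polynomial of an algebraic element of degree at most `r_j` at
`ξ(r, m)`. -/
lemma exists_le_absL_minpoly (hq : 1 < q) (p : ℕ) [Fact p.Prime] [CharP Fq p]
    (hr : ∃ e : ℕ, 0 < e ∧ r = p ^ e) (hm : ∀ j, 1 ≤ m j) (hm' : ∀ j, 1 ≤ j → 2 ≤ m j)
    {j D : ℕ} (hD : 0 < D) (hDj : rr r m (j + 1) = D + rr r m j ^ 2) {α : AC Fq}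
    {P : Polynomial (Polynomial Fq)} (hP : IsMinPolyOf Fq α P) (hdeg : P.natDegree ≤ rr r m j)
    (hheight : rr r m (j + 1) ≤ logHeight P) :
    ∃ t : ℕ, ((q : ℝ) ^ t)⁻¹ ≤
        absL Fq q ((minpoly (LaurentSeries Fq) α).eval (xi Fq r m)) ∧
      t * D ≤ logHeight P * (rr r m j * rr r m (j + 1) ^ 3) := by
  have hr2 : 2 ≤ r := by
    obtain ⟨e, he, rfl⟩ := hr
    exact (Fact.out : p.Prime).two_le.trans (Nat.le_self_pow he.ne' p)
  have hρ := two_le_rr hr2 hm j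
  have hR := two_le_rr hr2 hm (j + 1)
  have hq1 : (1 : ℝ) < q := by exact_mod_cast hq
  have hq0 : (0 : ℝ) < q := by positivity
  obtain ⟨N, hN, hN'⟩ : ∃ N, rr r m (j + 1) ^ N * D ≤ rr r m j * logHeight P ∧
      rr r m j * logHeight P < rr r m (j + 1) ^ (N + 1) * D := by
    have hex : ∃ N, rr r m j * logHeight P < rr r m (j + 1) ^ N * D :=
      ⟨_, (Nat.lt_pow_self hR).trans_le (Nat.le_mul_of_pos_right _ hD)⟩
    have hpos : Nat.find hex ≠ 0 := fun h0 => by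
      have := Nat.find_spec hex
      rw [h0] at this
      nlinarith
    obtain ⟨N, hN⟩ := Nat.exists_eq_succ_of_ne_zero hpos
    refine ⟨N, not_lt.1 (Nat.find_min hex (by omega)), ?_⟩
    have := Nat.find_spec hex
    rwa [hN] at this
  obtain ⟨Q, hQdeg, hQh, hQle, hQge⟩ := exists_polynomial_approx (Fq := Fq) hq p hr hm hm' j (N + 1)
  have hα_int : IsIntegral (LaurentSeries Fq) α := Algebra.IsIntegral.isIntegral α
  set ρ := rr r m j
  set R := rr r m (j + 1)
  set h := logHeight P
  set ε := absL Fq q ((minpoly (LaurentSeries Fq) α).eval (xi Fq r m)) with hε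
  have hexp : ((q : ℝ) ^ (ρ * R ^ (N + 1))) ^ P.natDegree * ((q : ℝ) ^ h) ^ Q.natDegree ≤
      (q : ℝ) ^ (ρ ^ 2 * R ^ (N + 1) + ρ * h) := by
    rw [← pow_mul, ← pow_mul, ← pow_add]
    refine pow_le_pow_right₀ hq1.le ?_
    have h1 := Nat.mul_le_mul_left (ρ * R ^ (N + 1)) hdeg
    have h2 := Nat.mul_le_mul_left h hQdeg
    nlinarith
  rcases le_or_one_le_of_irreducible hq hP.2.1 hP.2.2.1 hP.1 (natDegree_coeff_le_logHeight P) hQh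
    (absL_xi_le_one Fq hq) (minpoly.monic hα_int) (minpoly_dvd_of_isMinPolyOf hP) with hA | hB
  · refine ⟨R ^ (N + 1 + 2), hQge.trans ?_, ?_⟩
    · rwa [div_le_iff₀' (by positivity)]
    · calc R ^ (N + 1 + 2) * D = R ^ 3 * (R ^ N * D) := by ring
        _ ≤ R ^ 3 * (ρ * h) := Nat.mul_le_mul_left _ hN
        _ = h * (ρ * R ^ 3) := by ring
  · have hB' := hB.trans (mul_le_mul_of_nonneg_left hexp
      (le_max_of_le_left ((absV Fq hq).nonneg _)))
    rw [max_mul_of_nonneg _ _ (by positivity), le_max_iff] at hB'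
    rcases hB' with hB' | hB'
    · refine ⟨ρ ^ 2 * R ^ (N + 1) + ρ * h, ?_, ?_⟩
      · rwa [inv_le_iff_one_le_mul₀ (by positivity)]
      · have hDR : D ≤ R := by omega
        have hρR : ρ ^ 2 + 1 ≤ R := by omega
        calc (ρ ^ 2 * R ^ (N + 1) + ρ * h) * D
            = ρ ^ 2 * R * (R ^ N * D) + ρ * h * D := by ring
          _ ≤ ρ ^ 2 * R * (ρ * h) + ρ * h * R := by gcongr
          _ = (ρ ^ 2 + 1) * (ρ * h * R) := by ring
          _ ≤ R * (ρ * h * R) := by gcongr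
          _ ≤ R * (ρ * h * R) * R := Nat.le_mul_of_pos_right _ (by omega)
          _ = h * (ρ * R ^ 3) := by ring
    · exfalso
      have h1 := hB'.trans (mul_le_mul_of_nonneg_right hQle (by positivity))
      rw [← div_eq_inv_mul, one_le_div (by positivity), pow_le_pow_iff_right₀ hq1] at h1
      have h2 : R ^ (N + 1 + 1) = R ^ (N + 1) * D + ρ ^ 2 * R ^ (N + 1) := by
        rw [pow_succ, hDj]
        ring
      omega

end Approximation

end OotoT

open OotoT

/-- If `m_j ≥ 3` for all sufficiently large `j`, then for all
sufficiently large `j`, `w_{r_j}^*(ξ(r,m)) ≤ r_j r_{j+1}³/(r_{j+1} − r_j²) − 1`. -/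
theorem wnStar_xi_upper_bound (p : ℕ) (hp : p.Prime) (q : ℕ) (hq : ∃ e : ℕ, 0 < e ∧ q = p ^ e)
    (Fq : Type) [Field Fq] [Fintype Fq] [CharP Fq p] (hcard : Fintype.card Fq = q)
    (r : ℕ) (hr : ∃ e : ℕ, 0 < e ∧ r = p ^ e)
    (m : ℕ → ℕ) (hm0 : m 0 = 1) (hm : ∀ j : ℕ, 1 ≤ j → 2 ≤ m j)
    (hm3 : ∀ᶠ j in Filter.atTop, 3 ≤ m j) :
    ∀ᶠ j in Filter.atTop,
      wnStar Fq q (rr r m j) (xi Fq r m)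
        ≤ (((rr r m j : ℝ) * (rr r m (j + 1) : ℝ) ^ 3 /
            ((rr r m (j + 1) : ℝ) - (rr r m j : ℝ) ^ 2) - 1 : ℝ) : EReal) := by
  have : Fact p.Prime := ⟨hp⟩
  have hq1 : 1 < q := by
    obtain ⟨e, he, rfl⟩ := hq
    exact hp.one_lt.trans_le (Nat.le_self_pow he.ne' p)
  have hr2 : 2 ≤ r := by
    obtain ⟨e, he, rfl⟩ := hr
    exact hp.two_le.trans (Nat.le_self_pow he.ne' p)
  have hm1 : ∀ j, 1 ≤ m j := fun j => by
    rcases Nat.eq_zero_or_pos j with rfl | hj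
    · exact hm0.ge
    · exact one_le_two.trans (hm j hj)
  filter_upwards [(tendsto_add_atTop_nat 1).eventually hm3] with j hj
  have hρ := two_le_rr hr2 hm1 j
  obtain ⟨D, hD⟩ : ∃ D, rr r m (j + 1) = rr r m j ^ 2 + D := by
    refine Nat.exists_eq_add_of_le ?_
    rw [rr_succ]
    exact Nat.pow_le_pow_right (by omega) (by omega)
  have hDpos : 0 < D := by
    have : rr r m j ^ 2 < rr r m (j + 1) := by
      rw [rr_succ]
      exact Nat.pow_lt_pow_right (by omega) (by omega)
    omega
  refine sSup_le ?_
  rintro _ ⟨w, hw, rfl⟩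
  refine EReal.coe_le_coe_iff.2 ?_
  obtain ⟨α, ⟨halg, hdeg, -, hle⟩, hα⟩ :=
    (hw.sdiff (finite_setOf_logHeight_le (rr r m j) (rr r m (j + 1)))).nonempty
  rw [degT, dif_pos halg] at hdeg
  rw [heightT, dif_pos halg] at hle
  have hP := halg.choose_spec
  generalize halg.choose = P at hdeg hle hP
  have hheight : rr r m (j + 1) < logHeight P := by
    by_contra! hcon
    exact hα ⟨P, hP, hdeg, hcon⟩
  obtain ⟨t, ht, htD⟩ := exists_le_absL_minpoly hq1 p hr hm1 hm hDpos
    (hD.trans (add_comm _ _)) hP hdeg hheight.le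
  have hbound := (le_absC_of_le_absL hq1 ht).trans hle
  have hq0 : (0 : ℝ) < q := by positivity
  have hheightP : heightP Fq q P = (q : ℝ) ^ (logHeight P : ℝ) := by
    rw [heightP, if_neg hP.2.1.ne_zero, Real.rpow_natCast, logHeight]
  rw [hheightP, ← Real.rpow_mul hq0.le, ← Real.rpow_natCast, ← Real.rpow_neg hq0.le,
    Real.rpow_le_rpow_left_iff (by exact_mod_cast hq1)] at hbound
  have hDR : (rr r m (j + 1) : ℝ) - (rr r m j : ℝ) ^ 2 = D := by
    rw [hD]
    push_cast
    ring
  have hD0 : (0 : ℝ) < D := by exact_mod_cast hDpos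
  have hh0 : (0 : ℝ) < logHeight P := by exact_mod_cast (Nat.zero_le _).trans_lt hheight
  have htD' : (t : ℝ) * D ≤ logHeight P * (rr r m j * (rr r m (j + 1) : ℝ) ^ 3) := by
    exact_mod_cast htD
  rw [hDR, le_sub_iff_add_le, le_div_iff₀ hD0]
  refine le_of_mul_le_mul_left (le_trans ?_ htD') hh0
  rw [← mul_assoc]
  exact mul_le_mul_of_nonneg_right (by linarith) hD0.le
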